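/- Let n and k be positive integers, let m > 0 be a real number, and let p₁, …, p_n be positive reals with p₁ + ⋯ + p_n = ε. Then ∏_{i=1}^{n} (1 − (1 − e^{−m·p_i})^k) ≤ (1 − (1 − e^{−ε·m/n})^k)^n. -/

import Mathlib

open Finset in
/-- The ratio `u ^ (k - 1) / (1 + u + ⋯ + u ^ (k - 1))` is monotone in `u ≥ 0`, in
cross-multiplied form. -/
lemma pow_mul_geom_sum_le_pow_mul_geom_sum (k : ℕ) {u v : ℝ} (hu : 0 ≤ u) (huv : u ≤ v) :
    u ^ (k - 1) * ∑ j ∈ range k, v ^ j ≤ v ^ (k - 1) * ∑ j ∈ range k, u ^ j := by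
  rw [mul_sum, mul_sum]
  refine sum_le_sum fun j hj => ?_
  obtain ⟨d, hd⟩ : ∃ d, k - 1 = j + d :=
    Nat.exists_eq_add_of_le (by have := mem_range.1 hj; omega)
  have hv : 0 ≤ v := hu.trans huv
  have hpow : u ^ d ≤ v ^ d := pow_le_pow_left₀ hu huv d
  calc u ^ (k - 1) * v ^ j = u ^ j * v ^ j * u ^ d := by rw [hd, pow_add]; ring
    _ ≤ u ^ j * v ^ j * v ^ d := by gcongr
    _ = v ^ (k - 1) * u ^ j := by rw [hd, pow_add]; ring

lemma one_sub_exp_neg_mem_Ioo {x : ℝ} (hx : 0 < x) :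
    1 - Real.exp (-x) ∈ Set.Ioo (0 : ℝ) 1 :=
  ⟨sub_pos.2 (Real.exp_lt_one_iff.2 (neg_lt_zero.2 hx)), sub_lt_self _ (Real.exp_pos _)⟩

lemma one_sub_one_sub_exp_neg_pow_pos {k : ℕ} (hk : 0 < k) {x : ℝ} (hx : 0 < x) :
    0 < 1 - (1 - Real.exp (-x)) ^ k :=
  have hu := one_sub_exp_neg_mem_Ioo hx
  sub_pos.2 (pow_lt_one₀ hu.1.le hu.2 hk.ne')

open Finset in
lemma hasDerivAt_log_one_sub_one_sub_exp_neg_pow {k : ℕ} (hk : 0 < k) {x : ℝ} (hx : 0 < x) :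
    HasDerivAt (fun y => Real.log (1 - (1 - Real.exp (-y)) ^ k))
      (-(k * ((1 - Real.exp (-x)) ^ (k - 1) / ∑ j ∈ range k, (1 - Real.exp (-x)) ^ j))) x := by
  have hpos := one_sub_one_sub_exp_neg_pow_pos hk hx
  have h := (((((hasDerivAt_neg x).exp).const_sub 1).pow k).const_sub 1).log hpos.ne'
  refine h.congr_deriv ?_
  have hgeom := mul_neg_geom_sum (1 - Real.exp (-x)) k
  rw [sub_sub_cancel] at hgeom
  have hS : ∑ j ∈ range k, (1 - Real.exp (-x)) ^ j ≠ 0 := by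
    intro h0
    rw [h0, mul_zero] at hgeom
    exact hpos.ne hgeom
  simp only [Pi.pow_apply]
  rw [← hgeom]
  field_simp

open Finset in
lemma concaveOn_log_one_sub_one_sub_exp_neg_pow {k : ℕ} (hk : 0 < k) :
    ConcaveOn ℝ (Set.Ioi 0) (fun x => Real.log (1 - (1 - Real.exp (-x)) ^ k)) := by
  have hderiv := fun x (hx : x ∈ Set.Ioi (0 : ℝ)) =>
    hasDerivAt_log_one_sub_one_sub_exp_neg_pow hk hx
  refine AntitoneOn.concaveOn_of_deriv (convex_Ioi 0)
    (fun x hx => (hderiv x hx).continuousAt.continuousWithinAt) ?_ ?_ <;> rw [interior_Ioi]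
  · exact fun x hx => (hderiv x hx).differentiableAt.differentiableWithinAt
  · intro x hx y hy hxy
    rw [(hderiv x hx).deriv, (hderiv y hy).deriv]
    have hu := (one_sub_exp_neg_mem_Ioo hx).1
    have hv := (one_sub_exp_neg_mem_Ioo hy).1
    have huv : 1 - Real.exp (-x) ≤ 1 - Real.exp (-y) := by gcongr
    have hne : (range k).Nonempty := nonempty_range_iff.2 hk.ne'
    gcongr -(k * ?_)
    rw [div_le_div_iff₀ (sum_pos (fun j _ => pow_pos hu j) hne)
      (sum_pos (fun j _ => pow_pos hv j) hne)]
    exact pow_mul_geom_sum_le_pow_mul_geom_sum k hu.le huv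

/-- Jensen-type consequence of concavity (inequality (7) in the paper):
∏ᵢ (1 − (1 − e^{−m pᵢ})^k) ≤ (1 − (1 − e^{−εm/n})^k)^n for positive pᵢ summing to ε. -/
theorem jensen_prod_bound (n k : ℕ) (hn : 0 < n) (hk : 0 < k)
    (m : ℝ) (hm : 0 < m) (p : Fin n → ℝ) (hp : ∀ i, 0 < p i)
    (ε : ℝ) (hε : ∑ i, p i = ε) :
    ∏ i, (1 - (1 - Real.exp (-(m * p i))) ^ k)
      ≤ (1 - (1 - Real.exp (-(ε * m / (n : ℝ)))) ^ k) ^ n := by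
  have hn' : (n : ℝ) ≠ 0 := by exact_mod_cast hn.ne'
  have hmp : ∀ i, 0 < m * p i := fun i => mul_pos hm (hp i)
  have hε_pos : 0 < ε := hε ▸ Finset.sum_pos (fun i _ => hp i) ⟨⟨0, hn⟩, Finset.mem_univ _⟩
  have hmean : 0 < ε * m / n := by positivity
  have hjensen := (concaveOn_log_one_sub_one_sub_exp_neg_pow hk).le_map_sum
    (t := Finset.univ) (w := fun _ : Fin n => (n : ℝ)⁻¹) (p := fun i => m * p i)
    (fun _ _ => by positivity) (by simp [hn']) (fun i _ => hmp i)
  have hsum : ∑ i, (n : ℝ)⁻¹ * (m * p i) = ε * m / n := by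
    rw [← Finset.mul_sum, ← Finset.mul_sum, hε]
    ring
  simp only [smul_eq_mul, hsum] at hjensen
  rw [← Finset.mul_sum, inv_mul_le_iff₀ (by positivity)] at hjensen
  have hfactor := fun i => one_sub_one_sub_exp_neg_pow_pos hk (hmp i)
  rw [← Real.log_le_log_iff (Finset.prod_pos fun i _ => hfactor i)
    (pow_pos (one_sub_one_sub_exp_neg_pow_pos hk hmean) n),
    Real.log_prod (fun i _ => (hfactor i).ne'), Real.log_pow]
  exact hjensen
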